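/- Let f : ℝ² → ℂ be integrable, let s₀ > 0, and for an integer k ≥ 1 set t_k = s₀(2^{2k} − 1) (the Gaussian variance corresponding to downsizing ratio 2^{−k}, i.e. t = s₀/a² − s₀ with a = 2^{−k}). Then for all integers m, n ≥ 1 and every x ∈ ℝ²: (G(·, t_m) ⋆ (u ↦ (G(·, t_n) ⋆ f)(2ⁿ u)))(2^m x) = (G(·, t_{m+n}) ⋆ f)(2^{m+n} x). That is, blurring with variance t_n, subsampling by 2ⁿ, blurring with variance t_m and subsampling by 2^m coincides with blurring with variance t_{m+n} and subsampling by 2^{m+n}. -/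

import Mathlib

open MeasureTheory

/-- The 2-D Gauss–Weierstrass kernel `G(x, t) = (4πt)⁻¹ exp(−‖x‖²/(4t))`. -/
noncomputable def gaussKernel (x : EuclideanSpace ℝ (Fin 2)) (t : ℝ) : ℝ :=
  (4 * Real.pi * t)⁻¹ * Real.exp (-‖x‖ ^ 2 / (4 * t))

/-- Convolution `(g ⋆ f)(x) = ∫ g(y) f(x − y) dy` on `ℝ²`. -/
noncomputable def conv (g f : EuclideanSpace ℝ (Fin 2) → ℂ)
    (x : EuclideanSpace ℝ (Fin 2)) : ℂ :=
  ∫ y, g y * f (x - y)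

/-- `t_k = s₀ (2^{2k} − 1)`, the Gaussian variance for downsizing ratio `2^{−k}`. -/
noncomputable def tvar (s₀ : ℝ) (k : ℕ) : ℝ := s₀ * (2 ^ (2 * k) - 1)

theorem continuous_gaussKernel (t : ℝ) : Continuous fun x => gaussKernel x t := by
  unfold gaussKernel
  fun_prop

theorem integrable_gaussKernel {t : ℝ} (ht : 0 < t) :
    Integrable fun x => (gaussKernel x t : ℂ) := by
  have h := (GaussianFourier.integrable_cexp_neg_mul_sq_norm_add
    (V := EuclideanSpace ℝ (Fin 2)) (b := (((4 * t)⁻¹ : ℝ) : ℂ))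
    (by rw [Complex.ofReal_re]; positivity) 0 0).const_mul (((4 * Real.pi * t)⁻¹ : ℝ) : ℂ)
  refine h.congr (.of_forall fun x => ?_)
  simp only [gaussKernel]
  push_cast
  congr 2
  ring

theorem norm_gaussKernel_le {t : ℝ} (ht : 0 < t) (x : EuclideanSpace ℝ (Fin 2)) :
    ‖(gaussKernel x t : ℂ)‖ ≤ (4 * Real.pi * t)⁻¹ := by
  rw [Complex.norm_real, Real.norm_eq_abs, gaussKernel, abs_of_nonneg (by positivity)]
  refine mul_le_of_le_one_right (by positivity) (Real.exp_le_one_iff.2 ?_)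
  rw [neg_div]
  exact neg_nonpos.2 (by positivity)

/-- The Gauss–Weierstrass kernels form a convolution semigroup. -/
theorem integral_gaussKernel_mul_gaussKernel_sub {s t : ℝ} (hs : 0 < s) (ht : 0 < t)
    (w : EuclideanSpace ℝ (Fin 2)) :
    ∫ z, (gaussKernel z s : ℂ) * (gaussKernel (w - z) t : ℂ) = (gaussKernel w (s + t) : ℂ) := by
  have h := GaussianFourier.integral_cexp_neg_mul_sq_norm_add
    (V := EuclideanSpace ℝ (Fin 2)) (b := (((s + t) / (4 * s * t) : ℝ) : ℂ))
    (by rw [Complex.ofReal_re]; positivity) (((2 * t)⁻¹ : ℝ) : ℂ) w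
  have hsplit : ∀ z : EuclideanSpace ℝ (Fin 2),
      (gaussKernel z s : ℂ) * (gaussKernel (w - z) t : ℂ) =
        (((4 * Real.pi * s)⁻¹ * (4 * Real.pi * t)⁻¹ * Real.exp (-‖w‖ ^ 2 / (4 * t)) : ℝ) : ℂ) *
        Complex.exp (-(((s + t) / (4 * s * t) : ℝ) : ℂ) * ‖z‖ ^ 2 +
          (((2 * t)⁻¹ : ℝ) : ℂ) * (inner ℝ w z : ℝ)) := by
    intro z
    rw [gaussKernel, gaussKernel, norm_sub_sq_real]
    norm_cast
    rw [mul_mul_mul_comm, ← Real.exp_add, mul_assoc _ (Real.exp _), ← Real.exp_add]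
    congr 2
    field_simp
    ring
  simp_rw [hsplit]
  rw [integral_const_mul, h, finrank_euclideanSpace_fin, gaussKernel]
  simp only [Nat.cast_ofNat, ne_eq, OfNat.ofNat_ne_zero, not_false_eq_true, div_self,
    Complex.cpow_one]
  norm_cast
  have hexp : Real.exp (-‖w‖ ^ 2 / (4 * (s + t))) = Real.exp (-‖w‖ ^ 2 / (4 * t)) *
      Real.exp ((2 * t)⁻¹ ^ 2 * ‖w‖ ^ 2 / (4 * ((s + t) / (4 * s * t)))) := by
    rw [← Real.exp_add]
    congr 1
    field_simp
    ring
  rw [hexp]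
  field_simp

theorem conv_gaussKernel_conv_gaussKernel {f : EuclideanSpace ℝ (Fin 2) → ℂ} (hf : Integrable f)
    {s t : ℝ} (hs : 0 < s) (ht : 0 < t) (p : EuclideanSpace ℝ (Fin 2)) :
    conv (fun y => (gaussKernel y s : ℂ)) (conv (fun y => (gaussKernel y t : ℂ)) f) p =
      conv (fun y => (gaussKernel y (s + t) : ℂ)) f p := by
  have hint : Integrable (fun q : EuclideanSpace ℝ (Fin 2) × EuclideanSpace ℝ (Fin 2) =>
      (gaussKernel (q.2 - q.1) t : ℂ) * ((gaussKernel q.1 s : ℂ) * f (p - q.2)))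
      (volume.prod volume) := by
    refine ((integrable_gaussKernel hs).mul_prod (hf.comp_sub_left p)).bdd_mul
      (c := (4 * Real.pi * t)⁻¹) ?_ (.of_forall fun q => norm_gaussKernel_le ht _)
    exact (Complex.continuous_ofReal.comp ((continuous_gaussKernel t).comp
      (continuous_snd.sub continuous_fst))).aestronglyMeasurable
  calc conv (fun y => (gaussKernel y s : ℂ)) (conv (fun y => (gaussKernel y t : ℂ)) f) p
      = ∫ z, ∫ w, (gaussKernel (w - z) t : ℂ) * ((gaussKernel z s : ℂ) * f (p - w)) := by
        simp only [conv]
        congr 1 with z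
        rw [← integral_sub_right_eq_self _ z, ← integral_const_mul]
        congr 1 with w
        rw [sub_sub, add_sub_cancel]
        ring
    _ = ∫ w, ∫ z, (gaussKernel (w - z) t : ℂ) * ((gaussKernel z s : ℂ) * f (p - w)) :=
        integral_integral_swap hint
    _ = conv (fun y => (gaussKernel y (s + t) : ℂ)) f p := by
        simp only [conv]
        congr 1 with w
        rw [← integral_gaussKernel_mul_gaussKernel_sub hs ht, ← integral_mul_const]
        congr 1 with z
        ring

theorem gaussKernel_smul {c : ℝ} (hc : c ≠ 0) (y : EuclideanSpace ℝ (Fin 2)) (t : ℝ) :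
    gaussKernel (c • y) (c ^ 2 * t) = (c ^ 2)⁻¹ * gaussKernel y t := by
  have hexp : -(c ^ 2 * ‖y‖ ^ 2) / (4 * (c ^ 2 * t)) = -‖y‖ ^ 2 / (4 * t) := by
    rw [mul_left_comm, ← mul_neg, mul_div_mul_left _ _ (pow_ne_zero 2 hc)]
  rw [gaussKernel, gaussKernel, norm_smul, mul_pow, Real.norm_eq_abs, sq_abs, hexp,
    mul_left_comm, mul_inv, mul_assoc]

theorem conv_gaussKernel_comp_smul {c : ℝ} (hc : c ≠ 0) (t : ℝ)
    (h : EuclideanSpace ℝ (Fin 2) → ℂ) (p : EuclideanSpace ℝ (Fin 2)) :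
    conv (fun y => (gaussKernel y t : ℂ)) (fun u => h (c • u)) p =
      conv (fun y => (gaussKernel y (c ^ 2 * t) : ℂ)) h (c • p) := by
  have key := Measure.integral_comp_smul volume
    (fun z => (gaussKernel z (c ^ 2 * t) : ℂ) * h (c • p - z)) c
  rw [finrank_euclideanSpace_fin, abs_of_nonneg (by positivity)] at key
  have hc' : ((c : ℂ) ^ 2)⁻¹ ≠ 0 := by simpa using hc
  simp only [conv]
  simp only [gaussKernel_smul hc, ← smul_sub, Complex.real_smul, Complex.ofReal_mul, mul_assoc,
    integral_const_mul, Complex.ofReal_inv, Complex.ofReal_pow] at key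
  exact mul_left_cancel₀ hc' key

theorem tvar_pos {s₀ : ℝ} (hs₀ : 0 < s₀) {k : ℕ} (hk : 1 ≤ k) : 0 < tvar s₀ k :=
  mul_pos hs₀ (sub_pos.2 (one_lt_pow₀ one_lt_two (by omega)))

theorem tvar_add (s₀ : ℝ) (m n : ℕ) :
    tvar s₀ (m + n) = (2 ^ n) ^ 2 * tvar s₀ m + tvar s₀ n := by
  simp only [tvar]
  ring

theorem blur_subsample_compose (f : EuclideanSpace ℝ (Fin 2) → ℂ)
    (hf : Integrable f) (s₀ : ℝ) (hs₀ : 0 < s₀) (m n : ℕ) (hm : 1 ≤ m) (hn : 1 ≤ n)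
    (x : EuclideanSpace ℝ (Fin 2)) :
    conv (fun y => (gaussKernel y (tvar s₀ m) : ℂ))
        (fun u => conv (fun y => (gaussKernel y (tvar s₀ n) : ℂ)) f ((2 ^ n : ℝ) • u))
        ((2 ^ m : ℝ) • x)
      = conv (fun y => (gaussKernel y (tvar s₀ (m + n)) : ℂ)) f ((2 ^ (m + n) : ℝ) • x) := by
  have hc : (2 ^ n : ℝ) ≠ 0 := by positivity
  rw [conv_gaussKernel_comp_smul hc, conv_gaussKernel_conv_gaussKernel hf
    (mul_pos (by positivity) (tvar_pos hs₀ hm)) (tvar_pos hs₀ hn), ← tvar_add, smul_smul,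
    ← pow_add, add_comm n m]
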